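/- Let (R,𝔪) be a Cohen-Macaulay local ring with canonical module that is generically Gorenstein and not Gorenstein, let ω be a canonical ideal of R, and let x ∈ ω be an R-regular element. Then δ_R(R/xR) = 1, where δ_R(M) is Auslander's delta-invariant of M. -/

import Mathlib

open CategoryTheory

noncomputable section

/-- The Ext module `Ext^n_R(M, N)` for `R`-modules `M`, `N`. -/
abbrev ModExt (R : Type) [CommRing R] (n : ℕ) (M N : ModuleCat R) : ModuleCat R :=
  ((Ext R (ModuleCat R) n).obj (Opposite.op M)).obj N

/-- An `R`-module `M` has finite injective dimension if `Ext^i_R(-, M)` vanishes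
for all `i` beyond some bound. -/
def HasFiniteInjDim (R : Type) [CommRing R] (M : ModuleCat R) : Prop :=
  ∃ n : ℕ, ∀ (N : ModuleCat R) (i : ℕ), n < i → Subsingleton (ModExt R i N M)

/-- The depth of a module over a local ring, via Rees' characterization:
the least `n` with `Ext^n(k, M) ≠ 0`. -/
def moduleDepth (R : Type) [CommRing R] [IsLocalRing R] (M : ModuleCat R) : ℕ∞ :=
  sInf {n : ℕ∞ | ∃ m : ℕ, n = (m : ℕ∞) ∧
    Nontrivial (ModExt R m (ModuleCat.of R (IsLocalRing.ResidueField R)) M)}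

/-- A Noetherian local ring is Cohen-Macaulay if its depth equals its Krull dimension. -/
def IsCMLocalRing (R : Type) [CommRing R] [IsLocalRing R] : Prop :=
  IsNoetherianRing R ∧
    (moduleDepth R (ModuleCat.of R R) : WithBot ℕ∞) = ringKrullDim R

/-- A maximal Cohen-Macaulay module: finitely generated with depth equal to `dim R`. -/
def IsMCM (R : Type) [CommRing R] [IsLocalRing R] (X : ModuleCat R) : Prop :=
  Module.Finite R X ∧ (moduleDepth R X : WithBot ℕ∞) = ringKrullDim R

/-- A Cohen-Macaulay module of codimension one:
`depth M = dim M = dim R - 1`. -/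
def IsCMofCodimOne (R : Type) [CommRing R] [IsLocalRing R] (M : ModuleCat R) : Prop :=
  Module.Finite R M ∧ ∃ d : ℕ, ringKrullDim R = ((d + 1 : ℕ) : WithBot ℕ∞) ∧
    moduleDepth R M = (d : ℕ∞) ∧
    ringKrullDim (R ⧸ Module.annihilator R M) = ((d : ℕ) : WithBot ℕ∞)

/-- A Gorenstein local ring: Noetherian local with finite injective dimension over itself. -/
def IsGorensteinLocalRing (A : Type) [CommRing A] : Prop :=
  IsNoetherianRing A ∧ IsLocalRing A ∧ HasFiniteInjDim A (ModuleCat.of A A)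

/-- `R` is generically Gorenstein if its localization at every minimal prime is Gorenstein. -/
def IsGenericallyGorenstein (R : Type) [CommRing R] : Prop :=
  ∀ p ∈ minimalPrimes R, ∀ h : p.IsPrime,
    letI := h
    IsGorensteinLocalRing (Localization.AtPrime p)

/-- A canonical module of a local ring `R`: finitely generated, of finite injective
dimension, with `Ext^i(k, ω) ≅ k` for `i = dim R` and `Ext^i(k, ω) = 0` otherwise. -/
def IsCanonicalModule (R : Type) [CommRing R] [IsLocalRing R] (W : ModuleCat R) : Prop :=
  Module.Finite R W ∧ HasFiniteInjDim R W ∧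
    ∃ d : ℕ, ringKrullDim R = (d : ℕ) ∧
      Nonempty ((ModExt R d (ModuleCat.of R (IsLocalRing.ResidueField R)) W) ≃ₗ[R]
        IsLocalRing.ResidueField R) ∧
      ∀ i : ℕ, i ≠ d →
        Subsingleton (ModExt R i (ModuleCat.of R (IsLocalRing.ResidueField R)) W)

/-- A canonical ideal: an ideal of `R` which, as an `R`-module, is a canonical module. -/
def IsCanonicalIdeal (R : Type) [CommRing R] [IsLocalRing R] (I : Ideal R) : Prop :=
  IsCanonicalModule R (ModuleCat.of R I)

/-- `Y` and `X` have a common nonzero direct summand via the map `ι : Y → X`. -/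
def HasCommonSummandVia (R : Type) [CommRing R] {Y X : ModuleCat R}
    (ι : Y →ₗ[R] X) : Prop :=
  ∃ (N Y' X' : ModuleCat.{0} R), Nontrivial N ∧
    ∃ (e : Y ≃ₗ[R] N × Y') (f : X ≃ₗ[R] N × X') (ι' : Y' →ₗ[R] X'),
      ∀ y : Y, f (ι y) = ((e y).1, ι' (e y).2)

/-- `0 → Y → X → M → 0` is an MCM approximation of `M`. -/
def IsMCMApprox (R : Type) [CommRing R] [IsLocalRing R] (M Y X : ModuleCat R)
    (ι : Y →ₗ[R] X) (π : X →ₗ[R] M) : Prop :=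
  Module.Finite R M ∧ Module.Finite R Y ∧ IsMCM R X ∧ HasFiniteInjDim R Y ∧
    Function.Injective ι ∧ Function.Surjective π ∧ Function.Exact ι π

/-- `0 → Y → X → M → 0` is a minimal MCM approximation of `M`. -/
def IsMinMCMApprox (R : Type) [CommRing R] [IsLocalRing R] (M Y X : ModuleCat R)
    (ι : Y →ₗ[R] X) (π : X →ₗ[R] M) : Prop :=
  IsMCMApprox R M Y X ι π ∧ ¬ HasCommonSummandVia R ι

/-- `0 → M → Y → X → 0` is an FID hull of `M`. -/
def IsFIDHull (R : Type) [CommRing R] [IsLocalRing R] (M Y X : ModuleCat R)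
    (ι : M →ₗ[R] Y) (π : Y →ₗ[R] X) : Prop :=
  Module.Finite R M ∧ Module.Finite R Y ∧ HasFiniteInjDim R Y ∧
    (IsMCM R X ∨ Subsingleton X) ∧
    Function.Injective ι ∧ Function.Surjective π ∧ Function.Exact ι π

/-- `0 → M → Y → X → 0` is a minimal FID hull of `M`. -/
def IsMinFIDHull (R : Type) [CommRing R] [IsLocalRing R] (M Y X : ModuleCat R)
    (ι : M →ₗ[R] Y) (π : Y →ₗ[R] X) : Prop :=
  IsFIDHull R M Y X ι π ∧ ¬ HasCommonSummandVia R π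

/-- The free rank of a module: the largest `m` with `R^m` a direct summand. -/
def freeRank (R : Type) [CommRing R] (X : ModuleCat R) : ℕ∞ :=
  sSup {n : ℕ∞ | ∃ m : ℕ, n = (m : ℕ∞) ∧
    ∃ X' : ModuleCat.{0} R, Nonempty (X ≃ₗ[R] ((Fin m → R) × X'))}

/-- The `W`-rank of a module: the largest `m` with `W^m` a direct summand. -/
def wRank (R : Type) [CommRing R] (W X : ModuleCat R) : ℕ∞ :=
  sSup {n : ℕ∞ | ∃ m : ℕ, n = (m : ℕ∞) ∧
    ∃ X' : ModuleCat.{0} R, Nonempty (X ≃ₗ[R] ((Fin m → W) × X'))}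

/-- `M` and `N` are `W`-stably isomorphic. -/
def WStablyIso (R : Type) [CommRing R] (W M N : ModuleCat R) : Prop :=
  ∃ s t : ℕ, Nonempty ((M × (Fin s → W)) ≃ₗ[R] (N × (Fin t → W)))

/-- The quotient module `I/J` (realized as `I` modulo the elements of `J` lying in `I`). -/
abbrev qmod (R : Type) [CommRing R] (I J : Ideal R) : ModuleCat R :=
  ModuleCat.of R (I ⧸ (Submodule.comap I.subtype J))

theorem subsingleton_ext_of_subsingleton_modExt {R : Type} [CommRing R] {n : ℕ}
    {N M : ModuleCat R} (h : Subsingleton (ModExt R n N M)) :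
    Subsingleton (Abelian.Ext N M n) := by
  let P := projectiveResolution N
  have hex : (P.complex.linearYonedaObj R M).ExactAt n := by
    rw [HomologicalComplex.exactAt_iff_isZero_homology]
    exact (ModuleCat.isZero_of_subsingleton (ModExt R n N M)).of_iso (P.isoExt n M).symm
  refine subsingleton_of_forall_eq 0 fun α ↦ ?_
  cases n with
  | zero =>
    rw [HomologicalComplex.exactAt_iff' _ 0 0 1 (by simp) (by simp),
      ShortComplex.moduleCat_exact_iff] at hex
    obtain ⟨f, rfl⟩ := (Abelian.Ext.mk₀_bijective N M).2 α
    let p : P.complex.X 0 ⟶ N := P.π.f 0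
    have : Epi p := inferInstanceAs (Epi (P.π.f 0))
    have hp : P.complex.d 1 0 ≫ p = 0 := P.complex_d_comp_π_f_zero
    obtain ⟨g, hg⟩ := hex (p ≫ f) (by
      change P.complex.d 1 0 ≫ p ≫ f = 0
      rw [← Category.assoc, hp, Limits.zero_comp])
    have hf : P.complex.d 0 0 ≫ (show P.complex.X 0 ⟶ M from g) = p ≫ f := hg
    rw [P.complex.shape 0 0 (by simp), Limits.zero_comp] at hf
    have : f = 0 := by
      rw [← cancel_epi p, ← hf, Limits.comp_zero]
    simp [this]
  | succ n =>
    rw [HomologicalComplex.exactAt_iff' _ n (n + 1) (n + 2) (by simp) (by simp),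
      ShortComplex.moduleCat_exact_iff] at hex
    obtain ⟨f, hf, rfl⟩ := P.extMk_surjective α (n + 2) rfl
    obtain ⟨g, hg⟩ := hex f hf
    exact (P.extMk_eq_zero_iff f (n + 2) rfl hf n rfl).2 ⟨g, hg⟩

theorem ModuleCat.subsingleton_ext_of_shortExact {R : Type} [CommRing R]
    {S : ShortComplex (ModuleCat R)} (hS : S.ShortExact) {W : ModuleCat R} {i : ℕ}
    (h₁ : Subsingleton (Abelian.Ext S.X₁ W i)) (h₃ : Subsingleton (Abelian.Ext S.X₃ W i)) :
    Subsingleton (Abelian.Ext S.X₂ W i) := by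
  refine subsingleton_of_forall_eq 0 fun α ↦ ?_
  obtain ⟨β, rfl⟩ := Abelian.Ext.contravariant_sequence_exact₂ hS W α (Subsingleton.elim _ _)
  rw [Subsingleton.elim β 0, Abelian.Ext.comp_zero]

theorem ModuleCat.subsingleton_covariant_ext_of_shortExact {R : Type} [CommRing R]
    {S : ShortComplex (ModuleCat R)} (hS : S.ShortExact) {N : ModuleCat R} {i : ℕ}
    (h₁ : Subsingleton (Abelian.Ext N S.X₁ (i + 1))) (h₂ : Subsingleton (Abelian.Ext N S.X₂ i)) :
    Subsingleton (Abelian.Ext N S.X₃ i) := by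
  refine subsingleton_of_forall_eq 0 fun α ↦ ?_
  obtain ⟨β, rfl⟩ := Abelian.Ext.covariant_sequence_exact₃ _ hS α rfl (Subsingleton.elim _ _)
  rw [Subsingleton.elim β 0, Abelian.Ext.zero_comp]

theorem ModuleCat.subsingleton_ext_of_quotSMulTop {R : Type} [CommRing R] [IsLocalRing R]
    [IsNoetherianRing R] {M W : ModuleCat R} [Module.Finite R M] [Module.Finite R W] {x : R}
    (hx : x ∈ IsLocalRing.maximalIdeal R) (hreg : IsSMulRegular M x) {i : ℕ}
    (h : Subsingleton (Abelian.Ext (ModuleCat.of R (QuotSMulTop x M)) W (i + 1))) :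
    Subsingleton (Abelian.Ext M W i) := by
  by_contra! hntr
  have hxj : x ∈ (Module.annihilator R (Abelian.Ext M W i)).jacobson :=
    IsLocalRing.maximalIdeal_le_jacobson _ hx
  refine Submodule.top_ne_pointwise_smul_of_mem_jacobson_annihilator hxj ?_
  rw [eq_comm, eq_top_iff]
  intro α _
  obtain ⟨β, rfl⟩ := Abelian.Ext.contravariant_sequence_exact₁ hreg.smulShortComplex_shortExact
    W α (add_comm 1 i) (h.elim _ _)
  have hβ (β : Abelian.Ext M W i) :
      (Abelian.Ext.mk₀ (x • 𝟙 M)).comp β (zero_add i) = x • β := by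
    rw [Abelian.Ext.mk₀_smul, Abelian.Ext.smul_comp, Abelian.Ext.mk₀_id_comp]
  exact hβ β ▸ Submodule.smul_mem_pointwise_smul β x (⊤ : Submodule R _) trivial

theorem ModuleCat.subsingleton_ext_of_linearEquiv {R : Type} [CommRing R] {M N W : ModuleCat R}
    (e : M ≃ₗ[R] N) {i : ℕ} (h : Subsingleton (Abelian.Ext M W i)) :
    Subsingleton (Abelian.Ext N W i) := by
  refine subsingleton_of_forall_eq 0 fun α ↦ ?_
  rw [← Abelian.Ext.mk₀_id_comp α, ← e.toModuleIso.inv_hom_id, ← Abelian.Ext.mk₀_comp_mk₀,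
    Abelian.Ext.comp_assoc_of_second_deg_zero,
    Subsingleton.elim ((Abelian.Ext.mk₀ e.toModuleIso.hom).comp α _) 0, Abelian.Ext.comp_zero]

section

variable {R : Type} [CommRing R] [IsLocalRing R] [IsNoetherianRing R] {W : ModuleCat R}
  [Module.Finite R W] {d : ℕ}

/-- A cyclic module has vanishing `Ext` into `W` in degrees where the residue field does. -/
theorem ModuleCat.subsingleton_ext_of_residueField_of_cyclic
    (hW : ∀ i, d < i → Subsingleton
      (Abelian.Ext (ModuleCat.of R (IsLocalRing.ResidueField R)) W i))
    (N : ModuleCat R) (f : R →ₗ[R] N) (hf : Function.Surjective f) (i : ℕ) (hi : d < i) :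
    Subsingleton (Abelian.Ext N W i) := by
  generalize hI : LinearMap.ker f = I
  induction I using IsNoetherian.induction generalizing N i with
  | hgt I ih =>
  have : Module.Finite R N := Module.Finite.of_surjective f hf
  by_cases htop : I = ⊤
  · have : Subsingleton N := by
      refine subsingleton_of_forall_eq 0 fun n ↦ ?_
      obtain ⟨r, rfl⟩ := hf n
      rw [← LinearMap.mem_ker, hI, htop]
      trivial
    have := (isZero_of_subsingleton N).hasProjectiveDimensionLT_zero
    exact HasProjectiveDimensionLT.subsingleton N 0 i (Nat.zero_le i) W
  by_cases hmax : I = IsLocalRing.maximalIdeal R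
  · subst hmax
    exact subsingleton_ext_of_linearEquiv
      ((Submodule.quotEquivOfEq _ _ hI.symm).trans (f.quotKerEquivOfSurjective hf)) (hW i hi)
  have hle : I ≤ IsLocalRing.maximalIdeal R := IsLocalRing.le_maximalIdeal htop
  by_cases hprime : Ideal.IsPrime I
  · obtain ⟨y, hy, hyI⟩ := SetLike.exists_of_lt (lt_of_le_of_ne hle hmax)
    have hreg : IsSMulRegular N y := by
      rw [isSMulRegular_iff_right_eq_zero_of_smul]
      intro n hn
      obtain ⟨r, rfl⟩ := hf n
      rw [← map_smul, ← LinearMap.mem_ker, hI] at hn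
      rw [← LinearMap.mem_ker, hI]
      exact (hprime.mem_or_mem hn).resolve_left hyI
    refine subsingleton_ext_of_quotSMulTop hy hreg
      (ih _ ?_ _ ((Submodule.mkQ _).comp f) ((Submodule.mkQ_surjective _).comp hf) (i + 1)
        (by omega) rfl)
    refine lt_of_le_of_ne ?_ fun h ↦ hyI ?_
    · intro r hr
      rw [← hI, LinearMap.mem_ker] at hr
      simp [hr]
    · rw [h, LinearMap.mem_ker, LinearMap.comp_apply, Submodule.mkQ_apply,
        Submodule.Quotient.mk_eq_zero, show f y = y • f 1 by rw [← map_smul, smul_eq_mul, mul_one]]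
      exact Submodule.smul_mem_pointwise_smul (f 1) y (⊤ : Submodule R N) trivial
  · rw [Ideal.isPrime_iff] at hprime
    push Not at hprime
    obtain ⟨a, b, hab, ha, hb⟩ := hprime htop
    let g : R →ₗ[R] Submodule.span R {f a} :=
      LinearMap.toSpanSingleton R _ ⟨f a, Submodule.mem_span_singleton_self _⟩
    have hg : Function.Surjective g := by
      rintro ⟨n, hn⟩
      obtain ⟨r, rfl⟩ := Submodule.mem_span_singleton.1 hn
      exact ⟨r, rfl⟩
    have hgker : ∀ r, r ∈ LinearMap.ker g ↔ r * a ∈ I := by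
      intro r
      rw [LinearMap.mem_ker, Subtype.ext_iff, ← hI, LinearMap.mem_ker, ← smul_eq_mul, map_smul]
      rfl
    refine subsingleton_ext_of_shortExact
      (shortComplex_shortExact (shortComplexOfCompEqZero (Submodule.span R {f a}).subtype
        (Submodule.span R {f a}).mkQ (by ext; simp)) (LinearMap.exact_subtype_mkQ _)
        (Submodule.injective_subtype _) (Submodule.mkQ_surjective _))
      ?_ ?_
    · refine ih _ ?_ (ModuleCat.of R (Submodule.span R {f a})) g hg i hi rfl
      refine lt_of_le_of_ne (fun r hr ↦ (hgker r).2 (Ideal.mul_mem_right a I hr)) fun h ↦ hb ?_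
      rw [h, hgker, mul_comm]
      exact hab
    · refine ih _ ?_ (ModuleCat.of R (N ⧸ Submodule.span R {f a}))
        ((Submodule.mkQ _).comp f) ((Submodule.mkQ_surjective _).comp hf) i hi rfl
      refine lt_of_le_of_ne (fun r hr ↦ ?_) fun h ↦ ha ?_
      · rw [← hI, LinearMap.mem_ker] at hr
        simp [hr]
      · rw [h, LinearMap.mem_ker, LinearMap.comp_apply, Submodule.mkQ_apply,
          Submodule.Quotient.mk_eq_zero]
        exact Submodule.mem_span_singleton_self _

theorem ModuleCat.subsingleton_ext_of_residueField
    (hW : ∀ i, d < i → Subsingleton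
      (Abelian.Ext (ModuleCat.of R (IsLocalRing.ResidueField R)) W i))
    (N : Type) [AddCommGroup N] [Module R N] [hN : Module.Finite R N] (i : ℕ) (hi : d < i) :
    Subsingleton (Abelian.Ext (ModuleCat.of R N) W i) := by
  induction hN using IsNoetherianRing.induction_on_isQuotientEquivQuotientPrime R with
  | subsingleton N =>
    have := (isZero_of_subsingleton (ModuleCat.of R N)).hasProjectiveDimensionLT_zero
    exact HasProjectiveDimensionLT.subsingleton (ModuleCat.of R N) 0 i (Nat.zero_le i) W
  | quotient N p e =>
    exact subsingleton_ext_of_residueField_of_cyclic hW _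
      (e.symm.toLinearMap.comp p.asIdeal.mkQ)
      (e.symm.surjective.comp (Submodule.mkQ_surjective _)) i hi
  | exact N₁ N₂ N₃ f g hf hg hfg h₁ h₃ =>
    exact subsingleton_ext_of_shortExact
      (shortComplex_shortExact
        (shortComplexOfCompEqZero f g hfg.linearMap_comp_eq_zero) hfg hf hg) h₁ h₃

/-- If `Ext^i(k, X)` vanishes for `i < t` and `Ext^i(k, W)` vanishes for `i > d`, then
`Ext^i(X, W)` vanishes for `i > d - t`. -/
theorem ModuleCat.subsingleton_ext_of_depth_le {t : ℕ}
    (hW : ∀ i, d < i → Subsingleton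
      (Abelian.Ext (ModuleCat.of R (IsLocalRing.ResidueField R)) W i))
    (X : ModuleCat R) [Module.Finite R X]
    (hX : ∀ i < t, Subsingleton
      (Abelian.Ext (ModuleCat.of R (IsLocalRing.ResidueField R)) X i))
    (i : ℕ) (hi : d < i + t) :
    Subsingleton (Abelian.Ext X W i) := by
  induction t generalizing X i with
  | zero => exact subsingleton_ext_of_residueField hW X i hi
  | succ t ih =>
    have : Subsingleton (IsLocalRing.ResidueField R →ₗ[R] X) :=
      (Abelian.Ext.addEquiv₀.trans ModuleCat.homAddEquiv).symm.subsingleton_congr.2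
        (hX 0 t.succ_pos)
    obtain ⟨x, hx, hreg⟩ := IsSMulRegular.subsingleton_linearMap_iff.1 this
    have hxm : x ∈ IsLocalRing.maximalIdeal R := by
      rwa [← Ideal.annihilator_quotient (I := IsLocalRing.maximalIdeal R)]
    refine subsingleton_ext_of_quotSMulTop hxm hreg (ih _ (fun j hj ↦ ?_) (i + 1) (by omega))
    exact subsingleton_covariant_ext_of_shortExact hreg.smulShortComplex_shortExact
      (hX (j + 1) (by omega)) (hX j (by omega))

end

theorem subsingleton_ext_of_isMCM {R : Type} [CommRing R] [IsLocalRing R] [IsNoetherianRing R]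
    {X W : ModuleCat R} (hX : IsMCM R X) (hW : IsCanonicalModule R W) :
    Subsingleton (Abelian.Ext X W 1) := by
  obtain ⟨_, hdepth⟩ := hX
  obtain ⟨_, -, d, hd, -, hvan⟩ := hW
  have hdepth' : moduleDepth R X = (d : ℕ∞) := by
    rw [hd] at hdepth
    exact WithBot.coe_injective hdepth
  refine ModuleCat.subsingleton_ext_of_depth_le (d := d) (t := d)
    (fun i hi ↦ subsingleton_ext_of_subsingleton_modExt (hvan i hi.ne')) X (fun i hi ↦ ?_) 1
    (by omega)
  refine subsingleton_ext_of_subsingleton_modExt (not_nontrivial_iff_subsingleton.1 fun hn ↦ ?_)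
  have hle : moduleDepth R X ≤ (i : ℕ∞) := sInf_le ⟨i, rfl, hn⟩
  rw [hdepth', Nat.cast_le] at hle
  omega

/-- Homomorphisms into `N / W` lift to `N` when `Ext¹` into `W` vanishes. -/
theorem ModuleCat.exists_lift_mkQ {R : Type} [CommRing R] {X N : ModuleCat R} (W : Submodule R N)
    (h : Subsingleton (Abelian.Ext X (ModuleCat.of R W) 1)) (f : X →ₗ[R] N ⧸ W) :
    ∃ g : X →ₗ[R] N, W.mkQ.comp g = f := by
  have hS := shortComplex_shortExact
    (shortComplexOfCompEqZero W.subtype W.mkQ (by ext; simp))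
    (LinearMap.exact_subtype_mkQ W) W.subtype_injective W.mkQ_surjective
  obtain ⟨α, hα⟩ := Abelian.Ext.covariant_sequence_exact₃ X hS
    (Abelian.Ext.mk₀ (ModuleCat.ofHom f)) (zero_add 1) (h.elim _ _)
  obtain ⟨g, rfl⟩ := (Abelian.Ext.mk₀_bijective _ _).2 α
  rw [Abelian.Ext.mk₀_comp_mk₀] at hα
  exact ⟨g.hom, congrArg ModuleCat.Hom.hom ((Abelian.Ext.mk₀_bijective _ _).1 hα)⟩

theorem hasFiniteInjDim_of_linearEquiv {R : Type} [CommRing R] {M N : ModuleCat R}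
    (e : M ≃ₗ[R] N) (h : HasFiniteInjDim R M) : HasFiniteInjDim R N := by
  obtain ⟨n, hn⟩ := h
  exact ⟨n, fun L i hi ↦
    (((Ext R (ModuleCat R) i).obj (Opposite.op L)).mapIso
      e.toModuleIso).toLinearEquiv.symm.toEquiv.subsingleton_congr.2 (hn L i hi)⟩

theorem IsCanonicalIdeal.ne_top {R : Type} [CommRing R] [IsLocalRing R] [IsNoetherianRing R]
    (hnG : ¬ IsGorensteinLocalRing R) {ω : Ideal R} (hω : IsCanonicalIdeal R ω) : ω ≠ ⊤ := by
  rintro rfl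
  exact hnG ⟨inferInstance, inferInstance,
    hasFiniteInjDim_of_linearEquiv (M := ModuleCat.of R (⊤ : Ideal R)) (N := ModuleCat.of R R)
      Submodule.topEquiv hω.2.1⟩

/-- A linear form taking the value `1` splits off a free summand of rank one. -/
def LinearMap.prodKerEquivOfEqOne {R M : Type*} [CommRing R] [AddCommGroup M] [Module R M]
    (φ : M →ₗ[R] R) (m : M) (h : φ m = 1) : M ≃ₗ[R] R × LinearMap.ker φ where
  toLinearMap := φ.prod ((LinearMap.id - φ.smulRight m).codRestrict _ fun x ↦ by simp [h])
  invFun p := p.1 • m + p.2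
  left_inv x := by simp
  right_inv := by
    rintro ⟨r, y, hy⟩
    have hy' : φ y = 0 := hy
    ext <;> simp [h, hy']

theorem mem_maximalIdeal_of_not_hasCommonSummandVia {R : Type} [CommRing R] [IsLocalRing R]
    {Y X : ModuleCat.{0} R} {ι : Y →ₗ[R] X} (h : ¬ HasCommonSummandVia R ι) (φ : X →ₗ[R] R)
    (y : Y) : φ (ι y) ∈ IsLocalRing.maximalIdeal R := by
  by_contra hu
  have hu : IsUnit (φ (ι y)) := by simpa using hu
  obtain ⟨u, hu⟩ := hu.exists_left_inv
  have h₁ : φ (ι (u • y)) = 1 := by simp [hu]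
  refine h ⟨ModuleCat.of R R, ModuleCat.of R (LinearMap.ker (φ.comp ι)),
    ModuleCat.of R (LinearMap.ker φ), inferInstanceAs (Nontrivial R),
    (φ.comp ι).prodKerEquivOfEqOne (u • y) h₁, φ.prodKerEquivOfEqOne (ι (u • y)) h₁,
    ι.restrict fun y hy ↦ hy, fun z ↦ ?_⟩
  refine Prod.ext rfl (Subtype.ext ?_)
  change ι z - φ (ι z) • ι (u • y) = ι (z - φ (ι z) • (u • y))
  simp

/-- In a minimal approximation of a cyclic module the free rank of the middle term is at
most one. -/
theorem le_one_of_not_hasCommonSummandVia {R : Type} [CommRing R] [IsLocalRing R]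
    {Y X : ModuleCat.{0} R} {ι : Y →ₗ[R] X} (h : ¬ HasCommonSummandVia R ι) {x₀ : X}
    (hx₀ : ∀ x, ∃ (r : R) (y : Y), x = r • x₀ + ι y) {m : ℕ} (p : X →ₗ[R] (Fin m → R))
    (hp : Function.Surjective p) : m ≤ 1 := by
  by_contra! hm
  have key (e : Fin m → R) : ∃ r : R, ∀ j, e j - r * p x₀ j ∈ IsLocalRing.maximalIdeal R := by
    obtain ⟨x, rfl⟩ := hp e
    obtain ⟨r, y, rfl⟩ := hx₀ x
    exact ⟨r, fun j ↦ by
      simpa using mem_maximalIdeal_of_not_hasCommonSummandVia h (LinearMap.proj j ∘ₗ p) y⟩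
  have hunit (j : Fin m) : p x₀ j ∉ IsLocalRing.maximalIdeal R := fun hj ↦ by
    obtain ⟨r, hr⟩ := key 1
    have := add_mem (hr j) (Ideal.mul_mem_left _ r hj)
    simp at this
  obtain ⟨r, hr⟩ := key (Pi.single ⟨0, by omega⟩ 1)
  have h₁ := hr ⟨1, hm⟩
  rw [Pi.single_eq_of_ne (by simp), zero_sub, neg_mem_iff] at h₁
  have hr' := ((IsLocalRing.maximalIdeal.isMaximal R).isPrime.mem_or_mem h₁).resolve_right
    (hunit _)
  have := add_mem (hr ⟨0, by omega⟩) (Ideal.mul_mem_right (p x₀ ⟨0, by omega⟩) _ hr')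
  simp at this

theorem stmt12 (R : Type) [CommRing R] [IsLocalRing R]
    (hCM : IsCMLocalRing R) (hGG : IsGenericallyGorenstein R)
    (hnG : ¬ IsGorensteinLocalRing R)
    (ω : Ideal R) (hω : IsCanonicalIdeal R ω)
    (x : R) (hxω : x ∈ ω) (hxreg : x ∈ nonZeroDivisors R) :
    ∀ (Y X : ModuleCat R) (ι : Y →ₗ[R] X) (π : X →ₗ[R] ModuleCat.of R (R ⧸ Ideal.span {x})),
      IsMinMCMApprox R (ModuleCat.of R (R ⧸ Ideal.span {x})) Y X ι π → freeRank R X = 1 := by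
  rintro Y X ι π ⟨⟨-, -, hX, -, -, hπ, hexact⟩, hmin⟩
  have := hCM.1
  let q : R →ₗ[R] R ⧸ Ideal.span {x} := (Ideal.span {x}).mkQ
  obtain ⟨x₀, hx₀⟩ := hπ (q 1)
  refine le_antisymm (sSup_le ?_) (le_sSup ⟨1, by simp, ?_⟩)
  · rintro _ ⟨m, rfl, X', ⟨e⟩⟩
    have hgen (z : X) : ∃ (r : R) (y : Y), z = r • x₀ + ι y := by
      obtain ⟨r, hr⟩ := (Ideal.span {x}).mkQ_surjective (π z)
      obtain ⟨y, hy⟩ := (hexact (z - r • x₀)).1 (by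
        rw [map_sub, map_smul, hx₀, ← map_smul, smul_eq_mul, mul_one, sub_eq_zero]
        exact hr.symm)
      exact ⟨r, y, by rw [hy]; abel⟩
    exact_mod_cast le_one_of_not_hasCommonSummandVia hmin hgen
      ((LinearMap.fst R _ _).comp e.toLinearMap) (Prod.fst_surjective.comp e.surjective)
  · have hle : Ideal.span {x} ≤ ω := (Ideal.span_singleton_le_iff_mem _).2 hxω
    obtain ⟨g, hg⟩ := ModuleCat.exists_lift_mkQ (N := ModuleCat.of R R) ω
      (subsingleton_ext_of_isMCM hX hω) ((Submodule.factor hle).comp π)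
    have hgx : g x₀ - 1 ∈ ω := by
      rw [← Submodule.Quotient.eq]
      have := LinearMap.congr_fun hg x₀
      rw [LinearMap.comp_apply, LinearMap.comp_apply, hx₀] at this
      exact this
    have hu : IsUnit (g x₀) := by
      by_contra hnu
      have h₁ := sub_mem ((IsLocalRing.mem_maximalIdeal _).2 hnu)
        (IsLocalRing.le_maximalIdeal (hω.ne_top hnG) hgx)
      simp at h₁
    obtain ⟨u, hu⟩ := hu.exists_left_inv
    exact ⟨ModuleCat.of R (LinearMap.ker g),
      ⟨(LinearMap.prodKerEquivOfEqOne g (u • x₀) (by rw [map_smul]; exact hu)).trans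
        ((LinearEquiv.funUnique (Fin 1) R R).symm.prodCongr (LinearEquiv.refl R _))⟩⟩

end
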